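/- arXiv:2602.19856 — 4 statements merged into one kernel-verified Lean document; each statement's English description precedes it below -/
import Mathlib

section
/- Let θ ∈ (0,1), ϑ > 0, and β(α) = |α|^{(2θ−1)/2} for α ∈ ℝ. For every complex number λ ∈ ℂ \ (−∞, −ϑ] (i.e., λ + ϑ does not lie on the nonpositive real axis), the function α ↦ β(α)²/(λ + ϑ + α²) is integrable on ℝ and ∫_{−∞}^{+∞} β(α)²/(λ + ϑ + α²) dα = (π / sin(θπ)) · (λ + ϑ)^{θ−1}, where (λ+ϑ)^{θ−1} denotes the principal branch of the complex power. -/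
open MeasureTheory Real

theorem lintegral_rpow_div_add_sq {θ z : ℝ} (hθ : 0 < θ) (hθ' : θ < 1) (hz : 0 < z) :
    ∫⁻ α in Set.Ioi (0 : ℝ), ENNReal.ofReal (α ^ (2 * θ - 1) / (z + α ^ 2)) =
      ENNReal.ofReal (π / sin (θ * π) * z ^ (θ - 1) / 2) := by
  have laplace : ∀ α ∈ Set.Ioi (0 : ℝ), ENNReal.ofReal (α ^ (2 * θ - 1) / (z + α ^ 2)) =
      ∫⁻ t in Set.Ioi (0 : ℝ), ENNReal.ofReal (α ^ (2 * θ - 1) * exp (-(z + α ^ 2) * t)) := by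
    intro α hα
    have hα : 0 < α := hα
    have hneg : -(z + α ^ 2) < 0 := by linarith [sq_nonneg α]
    rw [← ofReal_integral_eq_lintegral_ofReal ((integrableOn_exp_mul_Ioi hneg 0).const_mul _)
      (.of_forall fun t => by positivity), integral_const_mul, integral_exp_mul_Ioi hneg]
    congr 1
    field_simp
    simp
  have gaussian : ∀ t ∈ Set.Ioi (0 : ℝ),
      ∫⁻ α in Set.Ioi (0 : ℝ), ENNReal.ofReal (α ^ (2 * θ - 1) * exp (-(z + α ^ 2) * t)) =
        ENNReal.ofReal (Gamma θ / 2 * (t ^ ((1 - θ) - 1) * exp (-(z * t)))) := by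
    intro t ht
    have ht : 0 < t := ht
    have hsplit : ∀ α : ℝ, α ^ (2 * θ - 1) * exp (-(z + α ^ 2) * t) =
        exp (-(z * t)) * (α ^ (2 * θ - 1) * exp (-t * α ^ (2 : ℝ))) := by
      intro α
      rw [mul_left_comm, ← exp_add, rpow_two]
      ring_nf
    simp_rw [hsplit]
    rw [← ofReal_integral_eq_lintegral_ofReal
      ((integrableOn_rpow_mul_exp_neg_mul_rpow (by linarith) two_pos ht).const_mul _)
      ((ae_restrict_mem measurableSet_Ioi).mono fun α (hα : 0 < α) => by positivity),
      integral_const_mul, integral_rpow_mul_exp_neg_mul_rpow two_pos (by linarith) ht]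
    congr 1
    rw [show -(2 * θ - 1 + 1) / 2 = 1 - θ - 1 by ring, show (2 * θ - 1 + 1) / 2 = θ by ring]
    ring
  rw [setLIntegral_congr_fun measurableSet_Ioi laplace,
    lintegral_lintegral_swap (by fun_prop), setLIntegral_congr_fun measurableSet_Ioi gaussian]
  have hint : IntegrableOn (fun t : ℝ => t ^ ((1 - θ) - 1) * exp (-(z * t))) (Set.Ioi 0) := by
    simpa using integrableOn_rpow_mul_exp_neg_mul_rpow (p := 1) (s := 1 - θ - 1)
      (by linarith) one_pos hz
  have hΓ := Gamma_pos_of_pos hθ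
  rw [← ofReal_integral_eq_lintegral_ofReal (hint.const_mul _)
      ((ae_restrict_mem measurableSet_Ioi).mono fun t (ht : 0 < t) => by positivity),
    integral_const_mul, integral_rpow_mul_exp_neg_mul_Ioi (by linarith) hz]
  congr 1
  rw [mul_comm θ π, ← Gamma_mul_Gamma_one_sub, one_div, inv_rpow hz.le, ← rpow_neg hz.le, neg_sub]
  ring

theorem integrableOn_rpow_div_add_sq {θ z : ℝ} (hθ : 0 < θ) (hθ' : θ < 1) (hz : 0 < z) :
    IntegrableOn (fun α : ℝ => α ^ (2 * θ - 1) / (z + α ^ 2)) (Set.Ioi 0) := by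
  refine ⟨Measurable.aestronglyMeasurable (by fun_prop), ?_⟩
  rw [hasFiniteIntegral_iff_ofReal
    ((ae_restrict_mem measurableSet_Ioi).mono fun t (ht : 0 < t) => by positivity),
    lintegral_rpow_div_add_sq hθ hθ' hz]
  exact ENNReal.ofReal_lt_top

theorem integral_abs_rpow_div_add_sq {θ z : ℝ} (hθ : 0 < θ) (hθ' : θ < 1) (hz : 0 < z) :
    ∫ α : ℝ, |α| ^ (2 * θ - 1) / (z + α ^ 2) = π / sin (θ * π) * z ^ (θ - 1) := by
  have hsin : 0 < sin (θ * π) :=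
    sin_pos_of_pos_of_lt_pi (by positivity) (by nlinarith [pi_pos])
  have h := integral_comp_abs (f := fun α : ℝ => α ^ (2 * θ - 1) / (z + α ^ 2))
  simp only [sq_abs] at h
  rw [h, integral_eq_lintegral_of_nonneg_ae
    ((ae_restrict_mem measurableSet_Ioi).mono fun t (ht : 0 < t) => by positivity)
    (integrableOn_rpow_div_add_sq hθ hθ' hz).1, lintegral_rpow_div_add_sq hθ hθ' hz,
    ENNReal.toReal_ofReal (by positivity)]
  ring

theorem integrable_abs_rpow_div_add_sq {θ z : ℝ} (hθ : 0 < θ) (hθ' : θ < 1) (hz : 0 < z) :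
    Integrable (fun α : ℝ => |α| ^ (2 * θ - 1) / (z + α ^ 2)) := by
  have hpos : IntegrableOn (fun α : ℝ => |α| ^ (2 * θ - 1) / (z + α ^ 2)) (Set.Ioi 0) :=
    (integrableOn_rpow_div_add_sq hθ hθ' hz).congr_fun
      (fun α (hα : 0 < α) => by simp only [abs_of_pos hα]) measurableSet_Ioi
  rw [← integrableOn_univ, ← Set.Iic_union_Ioi (a := (0 : ℝ)), integrableOn_union]
  refine ⟨?_, hpos⟩
  rw [← integrableOn_Ici_iff_integrableOn_Ioi, ← neg_zero] at hpos
  simpa using hpos.comp_neg_Iic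

theorem Complex.exists_mul_one_add_le_norm_add {z : ℂ} (hz : z ∈ Complex.slitPlane) :
    ∃ c > 0, ∀ w ∈ Metric.ball z c, ∀ s : ℝ, 0 ≤ s → c * (1 + s) ≤ ‖w + s‖ := by
  obtain ⟨d, hd, hball⟩ := Metric.isOpen_iff.1 Complex.isOpen_slitPlane z hz
  have hN := norm_nonneg z
  have hc : 0 < d / (1 + ‖z‖ + d) := by positivity
  refine ⟨d / (1 + ‖z‖ + d) / 2, by positivity, fun w hw s hs => ?_⟩
  have hzs : d ≤ ‖z + s‖ := by
    by_contra! hlt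
    have hmem : (-(s : ℂ)) ∈ Metric.ball z d := by
      rw [Metric.mem_ball, dist_comm, dist_eq_norm, sub_neg_eq_add]
      exact hlt
    have := hball hmem
    rw [Complex.mem_slitPlane_iff] at this
    simp at this
    linarith
  have hzs' : s - ‖z‖ ≤ ‖z + s‖ := by
    have := norm_sub_le (z + s) z
    rw [add_sub_cancel_left, Complex.norm_real, norm_of_nonneg hs] at this
    linarith
  have hz1 : d / (1 + ‖z‖ + d) * (1 + s) ≤ ‖z + s‖ := by
    rw [div_mul_eq_mul_div, div_le_iff₀ (by positivity)]
    nlinarith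
  have hw1 : ‖z + s‖ ≤ ‖w + s‖ + ‖w - z‖ := by
    have := norm_sub_le (w + s) (w - z)
    rwa [show w + (s : ℂ) - (w - z) = z + s by ring] at this
  rw [Metric.mem_ball, dist_eq_norm] at hw
  nlinarith

theorem integrable_and_differentiableAt_integral_abs_rpow_div_add_sq {θ : ℝ} (hθ : 0 < θ) (hθ' : θ < 1)
    {z : ℂ} (hz : z ∈ Complex.slitPlane) :
    Integrable (fun α : ℝ => ((|α| ^ (2 * θ - 1) : ℝ) : ℂ) / (z + (α : ℂ) ^ 2)) ∧
    DifferentiableAt ℂ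
      (fun w : ℂ => ∫ α : ℝ, ((|α| ^ (2 * θ - 1) : ℝ) : ℂ) / (w + (α : ℂ) ^ 2)) z := by
  obtain ⟨c, hc, hlow⟩ := Complex.exists_mul_one_add_le_norm_add hz
  have hlow' : ∀ w ∈ Metric.ball z c, ∀ α : ℝ, c * (1 + α ^ 2) ≤ ‖w + (α : ℂ) ^ 2‖ := by
    intro w hw α
    simpa using hlow w hw (α ^ 2) (sq_nonneg α)
  have hbase := integrable_abs_rpow_div_add_sq hθ hθ' one_pos
  have hzc : z ∈ Metric.ball z c := Metric.mem_ball_self hc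
  have hmeas : ∀ w : ℂ, AEStronglyMeasurable
      (fun α : ℝ => ((|α| ^ (2 * θ - 1) : ℝ) : ℂ) / (w + (α : ℂ) ^ 2)) := by
    intro w
    exact Measurable.aestronglyMeasurable (by fun_prop)
  have hint : Integrable (fun α : ℝ => ((|α| ^ (2 * θ - 1) : ℝ) : ℂ) / (z + (α : ℂ) ^ 2)) := by
    refine (hbase.const_mul c⁻¹).mono' (hmeas z) (.of_forall fun α => ?_)
    rw [norm_div, Complex.norm_real, norm_of_nonneg (by positivity), inv_mul_eq_div, div_div,
      mul_comm _ c]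
    exact div_le_div_of_nonneg_left (by positivity) (by positivity) (hlow' z hzc α)
  refine ⟨hint, ?_⟩
  refine (hasDerivAt_integral_of_dominated_loc_of_deriv_le
    (F' := fun w α => -((|α| ^ (2 * θ - 1) : ℝ) : ℂ) / (w + (α : ℂ) ^ 2) ^ 2)
    (bound := fun α => (c ^ 2)⁻¹ * (|α| ^ (2 * θ - 1) / (1 + α ^ 2)))
    (Metric.ball_mem_nhds z hc) (.of_forall hmeas) hint
    (Measurable.aestronglyMeasurable (by fun_prop))
    (.of_forall fun α w hw => ?_) (hbase.const_mul _)
    (.of_forall fun α w hw => ?_)).2.differentiableAt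
  · rw [norm_div, norm_neg, norm_pow, Complex.norm_real, norm_of_nonneg (by positivity),
      inv_mul_eq_div, div_div, mul_comm _ (c ^ 2)]
    refine div_le_div_of_nonneg_left (by positivity) (by positivity) ?_
    calc c ^ 2 * (1 + α ^ 2) ≤ (c * (1 + α ^ 2)) ^ 2 := by
          rw [mul_pow]
          gcongr
          nlinarith [sq_nonneg α, sq_nonneg (α ^ 2)]
      _ ≤ _ := by gcongr; exact hlow' w hw α
  · have hne : w + (α : ℂ) ^ 2 ≠ 0 :=
      norm_pos_iff.1 (lt_of_lt_of_le (by positivity) (hlow' w hw α))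
    have h := (hasDerivAt_const w ((|α| ^ (2 * θ - 1) : ℝ) : ℂ)).div
      ((hasDerivAt_id w).add_const ((α : ℂ) ^ 2)) hne
    simp only [zero_mul, mul_one, zero_sub, id_eq] at h
    exact h

theorem integral_abs_rpow_div_add_sq_of_mem_slitPlane {θ : ℝ} (hθ : 0 < θ) (hθ' : θ < 1)
    {z : ℂ} (hz : z ∈ Complex.slitPlane) :
    ∫ α : ℝ, ((|α| ^ (2 * θ - 1) : ℝ) : ℂ) / (z + (α : ℂ) ^ 2) =
      ((π / sin (θ * π) : ℝ) : ℂ) * z ^ ((θ : ℂ) - 1) := by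
  have hleft : AnalyticOnNhd ℂ
      (fun w : ℂ => ∫ α : ℝ, ((|α| ^ (2 * θ - 1) : ℝ) : ℂ) / (w + (α : ℂ) ^ 2))
      Complex.slitPlane :=
    DifferentiableOn.analyticOnNhd (fun w hw =>
      (integrable_and_differentiableAt_integral_abs_rpow_div_add_sq hθ hθ' hw).2.differentiableWithinAt)
      Complex.isOpen_slitPlane
  have hright : AnalyticOnNhd ℂ
      (fun w : ℂ => ((π / sin (θ * π) : ℝ) : ℂ) * w ^ ((θ : ℂ) - 1)) Complex.slitPlane :=
    fun w hw => analyticAt_const.mul (analyticAt_id.cpow analyticAt_const hw)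
  have hreal : ∀ x : ℝ, 0 < x →
      ∫ α : ℝ, ((|α| ^ (2 * θ - 1) : ℝ) : ℂ) / ((x : ℂ) + (α : ℂ) ^ 2) =
        ((π / sin (θ * π) : ℝ) : ℂ) * (x : ℂ) ^ ((θ : ℂ) - 1) := by
    intro x hx
    have h := congrArg (fun r : ℝ => (r : ℂ)) (integral_abs_rpow_div_add_sq hθ hθ' hx)
    simp only [← integral_complex_ofReal] at h
    push_cast [Complex.ofReal_cpow hx.le] at h ⊢
    exact h
  have htendsto : Filter.Tendsto (fun x : ℝ => (x : ℂ)) (nhdsWithin 1 {1}ᶜ)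
      (nhdsWithin (1 : ℂ) {1}ᶜ) := by
    refine tendsto_nhdsWithin_iff.2 ⟨?_, ?_⟩
    · exact (Complex.continuous_ofReal.tendsto' 1 1 (by simp)).mono_left nhdsWithin_le_nhds
    · filter_upwards [self_mem_nhdsWithin] with x hx
      simpa using hx
  refine hleft.eqOn_of_preconnected_of_frequently_eq hright
    (Complex.starConvex_one_slitPlane.isPathConnected
      Complex.one_mem_slitPlane).isConnected.isPreconnected
    (z₀ := 1) Complex.one_mem_slitPlane (htendsto.frequently (Filter.Eventually.frequently ?_)) hz
  filter_upwards [nhdsWithin_le_nhds (lt_mem_nhds (zero_lt_one' ℝ))] with x hx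
  exact hreal x hx

/-- For θ ∈ (0,1), ϑ > 0, β(α) = |α|^((2θ−1)/2), and λ ∈ ℂ with λ + ϑ off the
nonpositive real axis, the function α ↦ β(α)²/(λ + ϑ + α²) is integrable on ℝ and its integral
equals (π / sin(θπ)) · (λ + ϑ)^(θ−1) (principal branch). -/
theorem stmt_0 (θ ϑ : ℝ) (hθ : θ ∈ Set.Ioo (0:ℝ) 1) (hϑ : 0 < ϑ)
    (β : ℝ → ℝ) (hβ : ∀ α : ℝ, β α = |α| ^ ((2*θ - 1)/2))
    (lam : ℂ) (hlam : lam + (ϑ:ℂ) ∈ Complex.slitPlane) :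
    Integrable (fun α : ℝ => ((β α ^ 2 : ℝ) : ℂ) / (lam + (ϑ:ℂ) + (α:ℂ)^2)) ∧
    ∫ α : ℝ, ((β α ^ 2 : ℝ) : ℂ) / (lam + (ϑ:ℂ) + (α:ℂ)^2)
      = ((π / Real.sin (θ * π) : ℝ) : ℂ) * (lam + (ϑ:ℂ)) ^ ((θ : ℂ) - 1) := by
  have hsq : ∀ α : ℝ, β α ^ 2 = |α| ^ (2 * θ - 1) := by
    intro α
    rw [hβ, ← rpow_natCast, ← rpow_mul (abs_nonneg α)]
    congr 1
    push_cast
    ring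
  simp only [hsq]
  exact ⟨(integrable_and_differentiableAt_integral_abs_rpow_div_add_sq hθ.1 hθ.2 hlam).1,
    integral_abs_rpow_div_add_sq_of_mem_slitPlane hθ.1 hθ.2 hlam⟩
end

section
/- Let θ ∈ (0,1), ϑ > 0, β(α) = |α|^{(2θ−1)/2}, and let U : [0,∞) → ℝ be continuous. Define 𝒢(α,t) := β(α) ∫₀^t e^{−(α²+ϑ)(t−r)} U(r) dr for α ∈ ℝ and t ≥ 0. Then: (i) for every fixed α ∈ ℝ, the function t ↦ 𝒢(α,t) satisfies 𝒢(α,0) = 0 and ∂_t 𝒢(α,t) + (α² + ϑ) 𝒢(α,t) = β(α) U(t) for all t > 0; and (ii) for every t ≥ 0 the function α ↦ β(α) 𝒢(α,t) is integrable on ℝ and (sin(θπ)/π) · ∫_{−∞}^{+∞} β(α) 𝒢(α,t) dα = (1/Γ(1−θ)) ∫₀^t (t−r)^{−θ} e^{−ϑ(t−r)} U(r) dr, i.e., the output equals the exponentially weighted Riemann–Liouville fractional integral I^{1−θ,ϑ}U(t). -/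
open MeasureTheory Real

theorem hasDerivAt_integral_exp_mul {U : ℝ → ℝ} (hU : ContinuousOn U (Set.Ici 0)) (c : ℝ) {t : ℝ}
    (ht : 0 < t) :
    HasDerivAt (fun s : ℝ => ∫ r in (0:ℝ)..s, exp (-c * (s - r)) * U r)
      (U t - c * ∫ r in (0:ℝ)..t, exp (-c * (t - r)) * U r) t := by
  have factor (s : ℝ) : ∫ r in (0:ℝ)..s, exp (-c * (s - r)) * U r
      = exp (-c * s) * ∫ r in (0:ℝ)..s, exp (c * r) * U r := by
    rw [← intervalIntegral.integral_const_mul]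
    refine intervalIntegral.integral_congr fun r _ => ?_
    rw [← mul_assoc, ← exp_add]
    ring_nf
  have hcont : ContinuousOn (fun r => exp (c * r) * U r) (Set.Ici 0) :=
    (by fun_prop : Continuous fun r : ℝ => exp (c * r)).continuousOn.mul hU
  have hint : IntervalIntegrable (fun r => exp (c * r) * U r) volume 0 t :=
    (hcont.mono (by rw [Set.uIcc_of_le ht.le]; exact Set.Icc_subset_Ici_self)).intervalIntegrable
  have hderiv : HasDerivAt (fun s : ℝ => ∫ r in (0:ℝ)..s, exp (c * r) * U r)
      (exp (c * t) * U t) t :=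
    intervalIntegral.integral_hasDerivAt_right hint
      ((hcont.mono Set.Ioi_subset_Ici_self).stronglyMeasurableAtFilter isOpen_Ioi t ht)
      (hcont.continuousAt (Ici_mem_nhds ht))
  have hexp : HasDerivAt (fun s : ℝ => exp (-c * s)) (exp (-c * t) * -c) t := by
    simpa using ((hasDerivAt_id t).const_mul (-c)).exp
  simp_rw [factor]
  refine (hexp.mul hderiv).congr_deriv ?_
  have h1 : exp (-c * t) * exp (c * t) = 1 := by rw [← exp_add]; simp
  linear_combination U t * h1

theorem integral_abs_rpow_mul_exp_neg_mul_sq {θ s : ℝ} (hθ : 0 < θ) (hs : 0 < s) :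
    ∫ α : ℝ, |α| ^ (2 * θ - 1) * exp (-s * α ^ 2) = Gamma θ * s ^ (-θ) := by
  have h := integral_rpow_mul_exp_neg_mul_rpow (p := 2) (q := 2 * θ - 1) two_pos (by linarith) hs
  have habs := integral_comp_abs (f := fun x : ℝ => x ^ (2 * θ - 1) * exp (-s * x ^ (2:ℝ)))
  simp only [rpow_two, sq_abs] at h habs
  rw [habs, h, show -(2 * θ - 1 + 1) / 2 = -θ by ring, show (2 * θ - 1 + 1) / 2 = θ by ring]
  ring

theorem integrable_abs_rpow_mul_exp_neg_mul_sq {θ s : ℝ} (hθ : 0 < θ) (hs : 0 < s) :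
    Integrable fun α : ℝ => |α| ^ (2 * θ - 1) * exp (-s * α ^ 2) := by
  refine .of_integral_ne_zero ?_
  rw [integral_abs_rpow_mul_exp_neg_mul_sq hθ hs]
  exact (mul_pos (Gamma_pos_of_pos hθ) (rpow_pos_of_pos hs _)).ne'

theorem intervalIntegrable_weighted_fractional_kernel {θ : ℝ} (hθ : θ < 1) (ϑ : ℝ) {U : ℝ → ℝ}
    {t : ℝ} (ht : 0 ≤ t) (hU : ContinuousOn U (Set.Ici 0)) :
    IntervalIntegrable (fun r => (t - r) ^ (-θ) * (exp (-ϑ * (t - r)) * U r)) volume 0 t := by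
  have hpow : IntervalIntegrable (fun r => (t - r) ^ (-θ)) volume 0 t := by
    have h := (intervalIntegral.intervalIntegrable_rpow' (a := t) (b := 0)
      (by linarith : -1 < -θ)).comp_sub_left t
    simpa using h
  refine hpow.mul_continuousOn ?_
  refine (by fun_prop : Continuous fun r : ℝ => exp (-ϑ * (t - r))).continuousOn.mul (hU.mono ?_)
  rw [Set.uIcc_of_le ht]
  exact Set.Icc_subset_Ici_self

/-- The kernel whose iterated integrals give the diffusive representation of the weighted
fractional integral. -/
noncomputable def diffusiveKernel (θ ϑ : ℝ) (U : ℝ → ℝ) (t : ℝ) (p : ℝ × ℝ) : ℝ :=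
  |p.1| ^ (2 * θ - 1) * (exp (-(p.1 ^ 2 + ϑ) * (t - p.2)) * U p.2)

theorem diffusiveKernel_eq (θ ϑ : ℝ) (U : ℝ → ℝ) (t α r : ℝ) :
    diffusiveKernel θ ϑ U t (α, r)
      = |α| ^ (2 * θ - 1) * exp (-(t - r) * α ^ 2) * (exp (-ϑ * (t - r)) * U r) := by
  rw [diffusiveKernel, mul_assoc, ← mul_assoc (exp (-(t - r) * α ^ 2)), ← exp_add]
  ring_nf

theorem integral_diffusiveKernel {θ : ℝ} (hθ : 0 < θ) (ϑ : ℝ) (U : ℝ → ℝ) {t r : ℝ} (hr : r < t) :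
    ∫ α, diffusiveKernel θ ϑ U t (α, r)
      = Gamma θ * ((t - r) ^ (-θ) * (exp (-ϑ * (t - r)) * U r)) := by
  simp_rw [diffusiveKernel_eq]
  rw [integral_mul_const, integral_abs_rpow_mul_exp_neg_mul_sq hθ (sub_pos.2 hr), mul_assoc]

theorem integrable_diffusiveKernel {θ : ℝ} (hθ : θ ∈ Set.Ioo (0:ℝ) 1) (ϑ : ℝ) {U : ℝ → ℝ}
    {t : ℝ} (ht : 0 ≤ t) (hU : ContinuousOn U (Set.Ici 0)) :
    Integrable (diffusiveKernel θ ϑ U t) (volume.prod (volume.restrict (Set.Ioo 0 t))) := by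
  have hmeasU : AEStronglyMeasurable U (volume.restrict (Set.Ioo 0 t)) :=
    (hU.mono fun _ hr => hr.1.le).aestronglyMeasurable measurableSet_Ioo
  have hmeas : AEStronglyMeasurable (diffusiveKernel θ ϑ U t)
      (volume.prod (volume.restrict (Set.Ioo 0 t))) := by
    refine AEStronglyMeasurable.mul ?_ (AEStronglyMeasurable.mul ?_ hmeasU.comp_snd)
    · exact Measurable.aestronglyMeasurable (by fun_prop)
    · exact Measurable.aestronglyMeasurable (by fun_prop)
  refine (integrable_prod_iff' hmeas).2 ⟨?_, ?_⟩
  · refine (ae_restrict_iff' measurableSet_Ioo).2 (.of_forall fun r hr => ?_)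
    simp_rw [diffusiveKernel_eq]
    exact (integrable_abs_rpow_mul_exp_neg_mul_sq hθ.1 (sub_pos.2 hr.2)).mul_const _
  · have hnorm := (((intervalIntegrable_weighted_fractional_kernel hθ.2 ϑ ht hU).1.mono_set
      Set.Ioo_subset_Ioc_self).norm.const_mul (Gamma θ))
    refine hnorm.congr ((ae_restrict_iff' measurableSet_Ioo).2 (.of_forall fun r hr => ?_))
    have habs (α : ℝ) : ‖diffusiveKernel θ ϑ U t (α, r)‖
        = diffusiveKernel θ ϑ (fun r => |U r|) t (α, r) := by
      simp only [diffusiveKernel, norm_mul, norm_eq_abs, abs_exp,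
        abs_of_nonneg (rpow_nonneg (abs_nonneg α) _)]
    simp only [habs]
    rw [integral_diffusiveKernel hθ.1 ϑ _ hr.2, norm_mul, norm_mul, norm_eq_abs, norm_eq_abs,
      norm_eq_abs, abs_exp, abs_of_nonneg (rpow_nonneg (sub_pos.2 hr.2).le _)]

theorem sin_mul_pi_div_pi_mul_Gamma {θ : ℝ} (hθ : θ ∈ Set.Ioo (0:ℝ) 1) :
    sin (θ * π) / π * Gamma θ = 1 / Gamma (1 - θ) := by
  have hsin : 0 < sin (θ * π) :=
    sin_pos_of_pos_of_lt_pi (mul_pos hθ.1 pi_pos) (by nlinarith [pi_pos, hθ.2])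
  have hrefl := Real.Gamma_mul_Gamma_one_sub θ
  have hG : Gamma (1 - θ) ≠ 0 := (Gamma_pos_of_pos (sub_pos.2 hθ.2)).ne'
  rw [mul_comm π θ] at hrefl
  field_simp at hrefl ⊢
  linarith

/-- With θ ∈ (0,1), ϑ > 0, β(α) = |α|^((2θ−1)/2), U continuous on [0,∞) and
𝒢(α,t) = β(α) ∫₀ᵗ e^(−(α²+ϑ)(t−r)) U(r) dr, we have (i) 𝒢(α,0) = 0 and
∂ₜ𝒢 + (α²+ϑ)𝒢 = β(α)U(t) for t > 0, and (ii) for each t ≥ 0 the map α ↦ β(α)𝒢(α,t) is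
integrable with (sin(θπ)/π) ∫ β(α)𝒢(α,t) dα = (1/Γ(1−θ)) ∫₀ᵗ (t−r)^(−θ) e^(−ϑ(t−r)) U(r) dr. -/
theorem stmt_3 (θ ϑ : ℝ) (hθ : θ ∈ Set.Ioo (0:ℝ) 1) (hϑ : 0 < ϑ)
    (β : ℝ → ℝ) (hβ : ∀ α : ℝ, β α = |α| ^ ((2*θ - 1)/2))
    (U : ℝ → ℝ) (hU : ContinuousOn U (Set.Ici 0))
    (G : ℝ → ℝ → ℝ)
    (hG : ∀ α t : ℝ, G α t = β α * ∫ r in (0:ℝ)..t, Real.exp (-(α^2 + ϑ) * (t - r)) * U r) :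
    (∀ α : ℝ, G α 0 = 0 ∧ ∀ t : ℝ, 0 < t →
        HasDerivAt (G α) (β α * U t - (α^2 + ϑ) * G α t) t) ∧
    (∀ t : ℝ, 0 ≤ t →
      Integrable (fun α : ℝ => β α * G α t) ∧
      (Real.sin (θ * π) / π) * ∫ α : ℝ, β α * G α t
        = (1 / Real.Gamma (1 - θ)) *
            ∫ r in (0:ℝ)..t, (t - r) ^ (-θ) * Real.exp (-ϑ * (t - r)) * U r) := by
  have hβsq (α : ℝ) : β α * β α = |α| ^ (2 * θ - 1) := by
    rw [hβ, ← sq, ← rpow_natCast, ← rpow_mul (abs_nonneg α)]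
    norm_num
  refine ⟨fun α => ⟨by simp [hG], fun t ht => ?_⟩, fun t ht => ?_⟩
  · have h := (hasDerivAt_integral_exp_mul hU (α ^ 2 + ϑ) ht).const_mul (β α)
    rw [funext (hG α)]
    refine h.congr_deriv ?_
    ring
  have hker (α : ℝ) : β α * G α t = ∫ r in Set.Ioo 0 t, diffusiveKernel θ ϑ U t (α, r) := by
    simp only [diffusiveKernel]
    rw [integral_const_mul, ← hβsq, hG, ← mul_assoc, intervalIntegral.integral_of_le ht,
      integral_Ioc_eq_integral_Ioo]
  have hint := integrable_diffusiveKernel hθ ϑ ht hU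
  simp only [hker]
  refine ⟨hint.integral_prod_left, ?_⟩
  rw [integral_integral_swap (f := fun α r => diffusiveKernel θ ϑ U t (α, r)) hint,
    setIntegral_congr_fun measurableSet_Ioo
      (fun r hr => integral_diffusiveKernel hθ.1 ϑ U hr.2),
    integral_const_mul, ← mul_assoc, sin_mul_pi_div_pi_mul_Gamma hθ,
    intervalIntegral.integral_of_le ht, integral_Ioc_eq_integral_Ioo]
  simp only [mul_assoc]
end

section
/- Let θ ∈ (0,1), ϑ > 0, s > 0, β(α) = |α|^{(2θ−1)/2}, and T > 0. Let V : [0,T] → ℝ be continuously differentiable, let f₀ : [−s,0] → ℝ be continuous, and let z : [0,1] × [0,T] → ℝ be continuously differentiable and satisfy the transport equation s ∂_t z(ϱ,t) + ∂_ϱ z(ϱ,t) = 0 on [0,1] × [0,T], together with z(0,t) = V'(t) for all t ∈ [0,T] and z(ϱ,0) = f₀(−ϱ s) for all ϱ ∈ [0,1]. For each α ∈ ℝ, let 𝒢(α,·) : [0,T] → ℝ be continuously differentiable with 𝒢(α,0) = 0 and ∂_t 𝒢(α,t) + (α² + ϑ) 𝒢(α,t) = z(1,t) β(α) for all t ∈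 [0,T]. Define M(α,t) := ∫₀^t 𝒢(α,r) dr − (s β(α)/(α²+ϑ)) ∫₀¹ f₀(−ϱ s) dϱ + V(0) β(α)/(α²+ϑ). Then for all α ∈ ℝ and t ∈ [0,T]: (α² + ϑ) M(α,t) = −s β(α) ∫₀¹ z(ϱ,t) dϱ + V(t) β(α) − 𝒢(α,t). -/
open MeasureTheory Real

/-- A solution of the transport equation `s ∂ₜz + ∂_ϱz = 0` on `[0,1] × [0,t]` satisfies the
balance law for its mass `∫ z(ϱ, ·) dϱ`. -/
theorem transport_mass_balance {s t : ℝ} (ht : 0 ≤ t) {z zt zρ : ℝ → ℝ → ℝ}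
    (hz_cont : ContinuousOn (fun p : ℝ × ℝ => z p.1 p.2) (Set.Icc 0 1 ×ˢ Set.Icc 0 t))
    (hzt : ∀ ϱ ∈ Set.Icc (0:ℝ) 1, ∀ r ∈ Set.Icc (0:ℝ) t,
        HasDerivAt (fun τ => z ϱ τ) (zt ϱ r) r)
    (hzρ : ∀ ϱ ∈ Set.Icc (0:ℝ) 1, ∀ r ∈ Set.Icc (0:ℝ) t,
        HasDerivAt (fun x => z x r) (zρ ϱ r) ϱ)
    (hztc : ContinuousOn (fun p : ℝ × ℝ => zt p.1 p.2) (Set.Icc 0 1 ×ˢ Set.Icc 0 t))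
    (hzρc : ContinuousOn (fun p : ℝ × ℝ => zρ p.1 p.2) (Set.Icc 0 1 ×ˢ Set.Icc 0 t))
    (htransport : ∀ ϱ ∈ Set.Icc (0:ℝ) 1, ∀ r ∈ Set.Icc (0:ℝ) t, s * zt ϱ r + zρ ϱ r = 0) :
    s * ((∫ ϱ in (0:ℝ)..1, z ϱ t) - ∫ ϱ in (0:ℝ)..1, z ϱ 0)
      = (∫ r in (0:ℝ)..t, z 0 r) - ∫ r in (0:ℝ)..t, z 1 r := by
  have slice_fst {f : ℝ → ℝ → ℝ}
      (hf : ContinuousOn (fun p : ℝ × ℝ => f p.1 p.2) (Set.Icc 0 1 ×ˢ Set.Icc 0 t))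
      {r : ℝ} (hr : r ∈ Set.Icc 0 t) :
      IntervalIntegrable (fun ϱ => f ϱ r) volume 0 1 :=
    ContinuousOn.intervalIntegrable_of_Icc zero_le_one
      (hf.comp (f := fun ϱ => (ϱ, r)) (by fun_prop) fun ϱ hϱ => ⟨hϱ, hr⟩)
  have slice_snd {f : ℝ → ℝ → ℝ}
      (hf : ContinuousOn (fun p : ℝ × ℝ => f p.1 p.2) (Set.Icc 0 1 ×ˢ Set.Icc 0 t))
      {ϱ : ℝ} (hϱ : ϱ ∈ Set.Icc (0:ℝ) 1) :
      IntervalIntegrable (fun r => f ϱ r) volume 0 t :=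
    ContinuousOn.intervalIntegrable_of_Icc ht
      (hf.comp (f := fun r => (ϱ, r)) (by fun_prop) fun r hr => ⟨hϱ, hr⟩)
  have h0 : (0:ℝ) ∈ Set.Icc (0:ℝ) t := ⟨le_rfl, ht⟩
  have h1 : t ∈ Set.Icc (0:ℝ) t := ⟨ht, le_rfl⟩
  have k0 : (0:ℝ) ∈ Set.Icc (0:ℝ) 1 := ⟨le_rfl, zero_le_one⟩
  have k1 : (1:ℝ) ∈ Set.Icc (0:ℝ) 1 := ⟨zero_le_one, le_rfl⟩
  rw [← intervalIntegral.integral_sub (slice_fst hz_cont h1) (slice_fst hz_cont h0),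
    ← intervalIntegral.integral_sub (slice_snd hz_cont k0) (slice_snd hz_cont k1)]
  have time_increment : ∫ ϱ in (0:ℝ)..1, (z ϱ t - z ϱ 0)
      = ∫ ϱ in (0:ℝ)..1, ∫ r in (0:ℝ)..t, zt ϱ r := by
    refine intervalIntegral.integral_congr fun ϱ hϱ => ?_
    rw [Set.uIcc_of_le zero_le_one] at hϱ
    refine (intervalIntegral.integral_eq_sub_of_hasDerivAt (fun r hr => hzt ϱ hϱ r ?_)
      (slice_snd hztc hϱ)).symm
    rwa [Set.uIcc_of_le ht] at hr
  have swap : ∫ ϱ in (0:ℝ)..1, ∫ r in (0:ℝ)..t, zt ϱ r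
      = ∫ r in (0:ℝ)..t, ∫ ϱ in (0:ℝ)..1, zt ϱ r := by
    apply intervalIntegral_intervalIntegral_swap
    rw [Set.uIoc_of_le zero_le_one, Set.uIoc_of_le ht]
    exact (hztc.integrableOn_compact (isCompact_Icc.prod isCompact_Icc)).mono_set
      (Set.prod_mono Set.Ioc_subset_Icc_self Set.Ioc_subset_Icc_self)
  rw [time_increment, swap, ← intervalIntegral.integral_const_mul]
  refine intervalIntegral.integral_congr fun r hr => ?_
  rw [Set.uIcc_of_le ht] at hr
  have space_increment : ∫ ϱ in (0:ℝ)..1, zρ ϱ r = z 1 r - z 0 r :=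
    intervalIntegral.integral_eq_sub_of_hasDerivAt
      (fun ϱ hϱ => hzρ ϱ (by rwa [Set.uIcc_of_le zero_le_one] at hϱ) r hr) (slice_fst hzρc hr)
  have flux : s * ∫ ϱ in (0:ℝ)..1, zt ϱ r = -∫ ϱ in (0:ℝ)..1, zρ ϱ r := by
    rw [← intervalIntegral.integral_const_mul, ← intervalIntegral.integral_neg]
    refine intervalIntegral.integral_congr fun ϱ hϱ => ?_
    rw [Set.uIcc_of_le zero_le_one] at hϱ
    exact eq_neg_of_add_eq_zero_left (htransport ϱ hϱ r hr)
  simp only [flux, space_increment, neg_sub]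

/-- Pointwise identity underlying Lemma 5.1. With θ ∈ (0,1), ϑ > 0, s > 0,
β(α) = |α|^((2θ−1)/2), V a C¹ state, z a C¹ solution of the transport equation
s∂ₜz + ∂_ϱz = 0 on [0,1]×[0,T] with z(0,t) = V'(t) and z(ϱ,0) = f₀(−ϱs), and 𝒢(α,·) the C¹
solution of ∂ₜ𝒢 + (α²+ϑ)𝒢 = z(1,t)β(α), 𝒢(α,0) = 0, the functional
M(α,t) = ∫₀ᵗ 𝒢(α,r) dr − (sβ(α)/(α²+ϑ)) ∫₀¹ f₀(−ϱs) dϱ + V(0)β(α)/(α²+ϑ) satisfies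
(α²+ϑ)M(α,t) = −sβ(α)∫₀¹ z(ϱ,t) dϱ + V(t)β(α) − 𝒢(α,t). -/
theorem stmt_7 (θ ϑ s T : ℝ) (hθ : θ ∈ Set.Ioo (0:ℝ) 1) (hϑ : 0 < ϑ) (hs : 0 < s) (hT : 0 < T)
    (β : ℝ → ℝ) (hβ : ∀ α : ℝ, β α = |α| ^ ((2*θ - 1)/2))
    (V V' : ℝ → ℝ) (hV : ∀ t ∈ Set.Icc (0:ℝ) T, HasDerivAt V (V' t) t)
    (f₀ : ℝ → ℝ) (hf₀ : ContinuousOn f₀ (Set.Icc (-s) 0))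
    (z zt zρ : ℝ → ℝ → ℝ)
    (hz_cont : ContinuousOn (fun p : ℝ × ℝ => z p.1 p.2) (Set.Icc 0 1 ×ˢ Set.Icc 0 T))
    (hzt : ∀ ϱ ∈ Set.Icc (0:ℝ) 1, ∀ t ∈ Set.Icc (0:ℝ) T,
        HasDerivAt (fun τ => z ϱ τ) (zt ϱ t) t)
    (hzρ : ∀ ϱ ∈ Set.Icc (0:ℝ) 1, ∀ t ∈ Set.Icc (0:ℝ) T,
        HasDerivAt (fun r => z r t) (zρ ϱ t) ϱ)
    (hztc : ContinuousOn (fun p : ℝ × ℝ => zt p.1 p.2) (Set.Icc 0 1 ×ˢ Set.Icc 0 T))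
    (hzρc : ContinuousOn (fun p : ℝ × ℝ => zρ p.1 p.2) (Set.Icc 0 1 ×ˢ Set.Icc 0 T))
    (htransport : ∀ ϱ ∈ Set.Icc (0:ℝ) 1, ∀ t ∈ Set.Icc (0:ℝ) T,
        s * zt ϱ t + zρ ϱ t = 0)
    (hz0 : ∀ t ∈ Set.Icc (0:ℝ) T, z 0 t = V' t)
    (hzinit : ∀ ϱ ∈ Set.Icc (0:ℝ) 1, z ϱ 0 = f₀ (-ϱ * s))
    (G : ℝ → ℝ → ℝ) (hG0 : ∀ α : ℝ, G α 0 = 0)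
    (hGt : ∀ α : ℝ, ∀ t ∈ Set.Icc (0:ℝ) T,
        HasDerivAt (G α) (z 1 t * β α - (α^2 + ϑ) * G α t) t)
    (M : ℝ → ℝ → ℝ)
    (hM : ∀ α t : ℝ, M α t = (∫ r in (0:ℝ)..t, G α r)
        - (s * β α / (α^2 + ϑ)) * (∫ ϱ in (0:ℝ)..1, f₀ (-ϱ * s))
        + V 0 * β α / (α^2 + ϑ)) :
    ∀ α : ℝ, ∀ t ∈ Set.Icc (0:ℝ) T,
      (α^2 + ϑ) * M α t
        = -s * β α * (∫ ϱ in (0:ℝ)..1, z ϱ t) + V t * β α - G α t := by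
  intro α t ht
  have sub : Set.Icc 0 t ⊆ Set.Icc 0 T := Set.Icc_subset_Icc_right ht.2
  have sub_prod : Set.Icc (0:ℝ) 1 ×ˢ Set.Icc 0 t ⊆ Set.Icc (0:ℝ) 1 ×ˢ Set.Icc 0 T :=
    Set.prod_mono subset_rfl sub
  have uIcc_eq : Set.uIcc 0 t = Set.Icc 0 t := Set.uIcc_of_le ht.1
  have mass := transport_mass_balance ht.1 (hz_cont.mono sub_prod)
    (fun ϱ hϱ r hr => hzt ϱ hϱ r (sub hr)) (fun ϱ hϱ r hr => hzρ ϱ hϱ r (sub hr))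
    (hztc.mono sub_prod) (hzρc.mono sub_prod) (fun ϱ hϱ r hr => htransport ϱ hϱ r (sub hr))
  have trace {ϱ : ℝ} (hϱ : ϱ ∈ Set.Icc (0:ℝ) 1) :
      IntervalIntegrable (fun r => z ϱ r) volume 0 t :=
    ContinuousOn.intervalIntegrable_of_Icc ht.1 fun r hr =>
      (hzt ϱ hϱ r (sub hr)).continuousAt.continuousWithinAt
  have initial : ∫ ϱ in (0:ℝ)..1, z ϱ 0 = ∫ ϱ in (0:ℝ)..1, f₀ (-ϱ * s) := by
    refine intervalIntegral.integral_congr fun ϱ hϱ => hzinit ϱ ?_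
    rwa [Set.uIcc_of_le zero_le_one] at hϱ
  have inflow : ∫ r in (0:ℝ)..t, z 0 r = V t - V 0 := by
    refine intervalIntegral.integral_eq_sub_of_hasDerivAt (fun r hr => ?_) (trace (by simp))
    rw [uIcc_eq] at hr
    rw [hz0 r (sub hr)]
    exact hV r (sub hr)
  have hGi : IntervalIntegrable (G α) volume 0 t :=
    ContinuousOn.intervalIntegrable_of_Icc ht.1 fun r hr =>
      (hGt α r (sub hr)).continuousAt.continuousWithinAt
  have hz1i : IntervalIntegrable (fun r => z 1 r) volume 0 t := trace (by simp)
  have diffusion : (∫ r in (0:ℝ)..t, z 1 r) * β α - (α^2 + ϑ) * ∫ r in (0:ℝ)..t, G α r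
      = G α t := by
    rw [← intervalIntegral.integral_mul_const, ← intervalIntegral.integral_const_mul,
      ← intervalIntegral.integral_sub (hz1i.mul_const _) (hGi.const_mul _),
      intervalIntegral.integral_eq_sub_of_hasDerivAt
        (fun r hr => hGt α r (sub (uIcc_eq ▸ hr))) ((hz1i.mul_const _).sub (hGi.const_mul _)),
      hG0, sub_zero]
  have hpos : α^2 + ϑ ≠ 0 := by positivity
  rw [initial, inflow] at mass
  rw [hM]
  generalize (∫ ϱ in (0:ℝ)..1, f₀ (-ϱ * s)) = I at mass ⊢
  field_simp
  linear_combination β α * mass - diffusion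
end

section
/- Let s > 0 and T > 0, and let z : [0,1] × [0,T] → ℝ be continuously differentiable and satisfy the transport equation s ∂_t z(ϱ,t) + ∂_ϱ z(ϱ,t) = 0 on [0,1] × [0,T]. Then for every t ∈ (0,T), the function K₃(t) := s ∫₀¹ e^{−sϱ} |z(ϱ,t)|² dϱ is differentiable and K₃'(t) = −s ∫₀¹ e^{−sϱ} |z(ϱ,t)|² dϱ − e^{−s} |z(1,t)|² + |z(0,t)|². In particular K₃'(t) ≤ −s ∫₀¹ e^{−sϱ} |z(ϱ,t)|² dϱ + |z(0,t)|². -/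
open MeasureTheory Real

/-- Differentiation under the integral sign on a compact rectangle, for a parameter in the interior
of its range. -/
theorem hasDerivAt_intervalIntegral_of_continuousOn_rectangle {a b c d : ℝ} (hab : a ≤ b)
    {f f' : ℝ → ℝ → ℝ}
    (hf : ContinuousOn (fun p : ℝ × ℝ => f p.1 p.2) (Set.Icc a b ×ˢ Set.Icc c d))
    (hf' : ContinuousOn (fun p : ℝ × ℝ => f' p.1 p.2) (Set.Icc a b ×ˢ Set.Icc c d))
    (hderiv : ∀ x ∈ Set.Icc a b, ∀ t ∈ Set.Icc c d, HasDerivAt (fun τ => f x τ) (f' x t) t)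
    {t : ℝ} (ht : t ∈ Set.Ioo c d) :
    HasDerivAt (fun τ => ∫ x in a..b, f x τ) (∫ x in a..b, f' x t) t := by
  have slice : ∀ {g : ℝ → ℝ → ℝ},
      ContinuousOn (fun p : ℝ × ℝ => g p.1 p.2) (Set.Icc a b ×ˢ Set.Icc c d) →
      ∀ τ ∈ Set.Icc c d, IntervalIntegrable (fun x => g x τ) volume a b := by
    intro g hg τ hτ
    refine ContinuousOn.intervalIntegrable_of_Icc hab ?_
    exact hg.comp (f := fun x : ℝ => (x, τ)) (by fun_prop) fun x hx => ⟨hx, hτ⟩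
  obtain ⟨C, hC⟩ := (isCompact_Icc.prod isCompact_Icc).exists_bound_of_continuousOn hf'
  have hnhds : Set.Icc c d ∈ nhds t := Icc_mem_nhds ht.1 ht.2
  have htI : t ∈ Set.Icc c d := Set.Ioo_subset_Icc_self ht
  have hmem : ∀ x ∈ Set.uIoc a b, x ∈ Set.Icc a b := fun x hx => by
    rw [Set.uIoc_of_le hab] at hx
    exact Set.Ioc_subset_Icc_self hx
  refine (intervalIntegral.hasDerivAt_integral_of_dominated_loc_of_deriv_le
    (F := fun τ x => f x τ) (F' := fun τ x => f' x τ) (bound := fun _ => C)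
    hnhds ?_ (slice hf t htI) (slice hf' t htI).def'.aestronglyMeasurable ?_
    intervalIntegrable_const ?_).2
  · filter_upwards [hnhds] with τ hτ
    exact (slice hf τ hτ).def'.aestronglyMeasurable
  · exact .of_forall fun x hx τ hτ => hC (x, τ) ⟨hmem x hx, hτ⟩
  · exact .of_forall fun x hx τ hτ => hderiv x (hmem x hx) τ hτ

/-- For a C¹ solution z of the transport equation s∂ₜz + ∂_ϱz = 0 on
[0,1]×[0,T], the functional K₃(t) = s∫₀¹ e^(−sϱ)|z(ϱ,t)|² dϱ is differentiable on (0,T) with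
K₃'(t) = −s∫₀¹ e^(−sϱ)|z(ϱ,t)|² dϱ − e^(−s)|z(1,t)|² + |z(0,t)|², and in particular
K₃'(t) ≤ −s∫₀¹ e^(−sϱ)|z(ϱ,t)|² dϱ + |z(0,t)|². -/
theorem stmt_9 (s T : ℝ) (hs : 0 < s) (hT : 0 < T)
    (z zt zρ : ℝ → ℝ → ℝ)
    (hz_cont : ContinuousOn (fun p : ℝ × ℝ => z p.1 p.2) (Set.Icc 0 1 ×ˢ Set.Icc 0 T))
    (hzt : ∀ ϱ ∈ Set.Icc (0:ℝ) 1, ∀ t ∈ Set.Icc (0:ℝ) T,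
        HasDerivAt (fun τ => z ϱ τ) (zt ϱ t) t)
    (hzρ : ∀ ϱ ∈ Set.Icc (0:ℝ) 1, ∀ t ∈ Set.Icc (0:ℝ) T,
        HasDerivAt (fun r => z r t) (zρ ϱ t) ϱ)
    (hztc : ContinuousOn (fun p : ℝ × ℝ => zt p.1 p.2) (Set.Icc 0 1 ×ˢ Set.Icc 0 T))
    (hzρc : ContinuousOn (fun p : ℝ × ℝ => zρ p.1 p.2) (Set.Icc 0 1 ×ˢ Set.Icc 0 T))
    (htransport : ∀ ϱ ∈ Set.Icc (0:ℝ) 1, ∀ t ∈ Set.Icc (0:ℝ) T,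
        s * zt ϱ t + zρ ϱ t = 0) :
    ∀ t ∈ Set.Ioo (0:ℝ) T,
      HasDerivAt (fun τ => s * ∫ ϱ in (0:ℝ)..1, Real.exp (-s * ϱ) * (z ϱ τ) ^ 2)
        (-s * (∫ ϱ in (0:ℝ)..1, Real.exp (-s * ϱ) * (z ϱ t) ^ 2)
          - Real.exp (-s) * (z 1 t) ^ 2 + (z 0 t) ^ 2) t ∧
      (-s * (∫ ϱ in (0:ℝ)..1, Real.exp (-s * ϱ) * (z ϱ t) ^ 2)
          - Real.exp (-s) * (z 1 t) ^ 2 + (z 0 t) ^ 2)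
        ≤ -s * (∫ ϱ in (0:ℝ)..1, Real.exp (-s * ϱ) * (z ϱ t) ^ 2) + (z 0 t) ^ 2 := by
  intro t ht
  have htI : t ∈ Set.Icc (0:ℝ) T := Set.Ioo_subset_Icc_self ht
  refine ⟨?_, by nlinarith [mul_nonneg (Real.exp_pos (-s)).le (sq_nonneg (z 1 t))]⟩
  have slice : ∀ {g : ℝ → ℝ → ℝ},
      ContinuousOn (fun p : ℝ × ℝ => g p.1 p.2) (Set.Icc 0 1 ×ˢ Set.Icc 0 T) →
      ContinuousOn (fun ϱ => g ϱ t) (Set.Icc 0 1) := fun hg =>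
    hg.comp (f := fun x : ℝ => (x, t)) (by fun_prop) fun x hx => ⟨hx, htI⟩
  have hz := slice hz_cont
  have hzr := slice hzρc
  have hderiv := (hasDerivAt_intervalIntegral_of_continuousOn_rectangle (zero_le_one' ℝ)
    (f := fun ϱ τ => Real.exp (-s * ϱ) * z ϱ τ ^ 2)
    (f' := fun ϱ τ => Real.exp (-s * ϱ) * (2 * z ϱ τ * zt ϱ τ))
    (by fun_prop) (by fun_prop)
    (fun ϱ hϱ τ hτ => by
      simpa using ((hzt ϱ hϱ τ hτ).pow 2).const_mul (Real.exp (-s * ϱ))) ht).const_mul s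
  have hint : IntervalIntegrable (fun ϱ => Real.exp (-s * ϱ) * z ϱ t ^ 2) volume 0 1 :=
    ContinuousOn.intervalIntegrable_of_Icc zero_le_one (by fun_prop)
  have hint' : IntervalIntegrable (fun ϱ => -s * (Real.exp (-s * ϱ) * z ϱ t ^ 2) +
      Real.exp (-s * ϱ) * (2 * z ϱ t * zρ ϱ t)) volume 0 1 :=
    ContinuousOn.intervalIntegrable_of_Icc zero_le_one (by fun_prop)
  have hftc := intervalIntegral.integral_eq_sub_of_hasDerivAt
    (f := fun ϱ => Real.exp (-s * ϱ) * z ϱ t ^ 2) (fun ϱ hϱ => by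
      rw [Set.uIcc_of_le zero_le_one] at hϱ
      have h := (((hasDerivAt_id ϱ).const_mul (-s)).exp).mul ((hzρ ϱ hϱ t htI).pow 2)
      refine h.congr_deriv ?_
      simp
      ring) hint'
  refine hderiv.congr_deriv ?_
  have hsplit : s * ∫ ϱ in (0:ℝ)..1, Real.exp (-s * ϱ) * (2 * z ϱ t * zt ϱ t) =
      -s * (∫ ϱ in (0:ℝ)..1, Real.exp (-s * ϱ) * z ϱ t ^ 2) -
      ∫ ϱ in (0:ℝ)..1, (-s * (Real.exp (-s * ϱ) * z ϱ t ^ 2) +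
        Real.exp (-s * ϱ) * (2 * z ϱ t * zρ ϱ t)) := by
    rw [← intervalIntegral.integral_const_mul, ← intervalIntegral.integral_const_mul,
      ← intervalIntegral.integral_sub (hint.const_mul _) hint']
    refine intervalIntegral.integral_congr fun ϱ hϱ => ?_
    rw [Set.uIcc_of_le zero_le_one] at hϱ
    linear_combination (Real.exp (-s * ϱ) * (2 * z ϱ t)) * htransport ϱ hϱ t htI
  rw [hsplit, hftc]
  simp only [mul_one, mul_zero, Real.exp_zero, one_mul]
  ring
end
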